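/- For generic p, q, r ∈ (ℝ/ℤ)², let N_cyc(p,q,r) denote the number of indices j ∈ {0,1,2} such that both triples of the pair P_j are counterclockwise. Then N_cyc is not constant on generic triples: there exist generic triples (p, q, r) and (p′, q′, r′) in ((ℝ/ℤ)²)³ with N_cyc(p,q,r) = 1 and N_cyc(p′,q′,r′) = 0. Consequently, the number of holomorphic discs with boundary on the Clifford torus in ℂP² passing through three generic points in the prescribed cyclic order depends on the choice of the points and is not an invariant. -/

import Mathlib

/-!
Statement 5: Part (3) of Proposition 2.2 of "On the counting of holomorphic discs
in toric Fano manifolds" (Cho), in the angle coordinates of the Clifford torus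
`(ℝ/ℤ)²`.  The number `N_cyc(p,q,r)` of indices `j ∈ {0,1,2}` for which both
triples of the pair `P_j` are counterclockwise — i.e. the number of holomorphic
discs through `p, q, r` in the prescribed cyclic order — is not constant on
generic triples: it takes the values `1` and `0`.
-/

attribute [local instance] Classical.propDecidable

/-- The circle `ℝ/ℤ`. -/
abbrev T1 : Type := AddCircle (1 : ℝ)

/-- `(a, b, c)` is counterclockwise on `ℝ/ℤ`. -/
def CCWc (a b c : T1) : Prop :=
  ∃ x y z : ℝ, x < y ∧ y < z ∧ z < x + 1 ∧
    (x : T1) = a ∧ (y : T1) = b ∧ (z : T1) = c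

/-- `a, b, c` are pairwise distinct. -/
def Distinct3 (a b c : T1) : Prop := a ≠ b ∧ b ≠ c ∧ a ≠ c

/-- Genericity: all six triples appearing in `P₀, P₁, P₂` consist of pairwise
distinct elements of `ℝ/ℤ`. -/
def Generic (p q r : T1 × T1) : Prop :=
  Distinct3 p.1 q.1 r.1 ∧ Distinct3 p.2 q.2 r.2 ∧
  Distinct3 (-p.1) (-q.1) (-r.1) ∧ Distinct3 (p.2 - p.1) (q.2 - q.1) (r.2 - r.1) ∧
  Distinct3 (p.1 - p.2) (q.1 - q.2) (r.1 - r.2) ∧ Distinct3 (-p.2) (-q.2) (-r.2)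

/-- `N_cyc(p,q,r)`: the number of indices `j ∈ {0,1,2}` such that both triples of
the pair `P_j` are counterclockwise. -/
noncomputable def Ncyc (p q r : T1 × T1) : ℕ :=
  (if CCWc p.1 q.1 r.1 ∧ CCWc p.2 q.2 r.2 then 1 else 0)
  + (if CCWc (-p.1) (-q.1) (-r.1) ∧ CCWc (p.2 - p.1) (q.2 - q.1) (r.2 - r.1) then 1 else 0)
  + (if CCWc (p.1 - p.2) (q.1 - q.2) (r.1 - r.2) ∧ CCWc (-p.2) (-q.2) (-r.2) then 1 else 0)

theorem T1.coe_eq_coe_iff (x y : ℝ) : (x : T1) = y ↔ ∃ n : ℤ, y = x + n := by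
  rw [eq_comm, ← sub_eq_zero, ← AddCircle.coe_sub, AddCircle.coe_eq_zero_iff]
  constructor
  · rintro ⟨n, hn⟩
    refine ⟨n, ?_⟩
    rw [zsmul_one] at hn
    linarith
  · rintro ⟨n, hn⟩
    refine ⟨n, ?_⟩
    rw [zsmul_one]
    linarith

theorem T1.coe_ne_coe {x y : ℝ} (hxy : x < y) (hyx : y < x + 1) : (x : T1) ≠ y := by
  rw [Ne, T1.coe_eq_coe_iff]
  rintro ⟨n, rfl⟩
  have h₀ : 0 < n := by exact_mod_cast (by linarith : (0 : ℝ) < n)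
  have h₁ : n < 1 := by exact_mod_cast (by linarith : (n : ℝ) < 1)
  omega

theorem CCWc.distinct3 {a b c : T1} (h : CCWc a b c) : Distinct3 a b c := by
  obtain ⟨x, y, z, hxy, hyz, hzx, rfl, rfl, rfl⟩ := h
  exact ⟨T1.coe_ne_coe hxy (by linarith), T1.coe_ne_coe hyz (by linarith),
    T1.coe_ne_coe (by linarith) hzx⟩

theorem CCWc.not_swap {a b c : T1} (h : CCWc a b c) : ¬ CCWc a c b := by
  obtain ⟨x, y, z, hxy, hyz, hzx, rfl, rfl, rfl⟩ := h
  rintro ⟨x', z', y', hxz', hzy', hyx', hx, hz, hy⟩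
  rw [eq_comm, T1.coe_eq_coe_iff] at hx hy hz
  obtain ⟨k, rfl⟩ := hx
  obtain ⟨m, rfl⟩ := hy
  obtain ⟨n, rfl⟩ := hz
  have h₁ : k < n + 1 := by exact_mod_cast (by linarith : (k : ℝ) < n + 1)
  have h₂ : m < k + 1 := by exact_mod_cast (by linarith : (m : ℝ) < k + 1)
  have h₃ : (m : ℝ) ≤ n := by exact_mod_cast (by omega : m ≤ n)
  linarith

theorem CCWc.neg {a b c : T1} (h : CCWc a b c) : CCWc (-a) (-c) (-b) := by
  obtain ⟨x, y, z, hxy, hyz, hzx, rfl, rfl, rfl⟩ := h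
  exact ⟨-x - 1, -z, -y, by linarith, by linarith, by linarith,
    (T1.coe_eq_coe_iff _ _).2 ⟨1, by push_cast; ring⟩, rfl, rfl⟩

theorem Distinct3.swap {a b c : T1} (h : Distinct3 a b c) : Distinct3 a c b :=
  ⟨h.2.2, h.2.1.symm, h.1⟩

theorem Distinct3.neg {a b c : T1} (h : Distinct3 a b c) : Distinct3 (-a) (-b) (-c) :=
  ⟨neg_injective.ne h.1, neg_injective.ne h.2.1, neg_injective.ne h.2.2⟩

theorem Generic.of_distinct3 {p q r : T1 × T1} (hx : Distinct3 p.1 q.1 r.1)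
    (hy : Distinct3 p.2 q.2 r.2) (hxy : Distinct3 (p.1 - p.2) (q.1 - q.2) (r.1 - r.2)) :
    Generic p q r :=
  ⟨hx, hy, hx.neg, by simpa only [neg_sub] using hxy.neg, hxy, hy.neg⟩

theorem Ncyc_eq_one {p q r : T1 × T1} (hx : CCWc p.1 q.1 r.1) (hy : CCWc p.2 q.2 r.2) :
    Ncyc p q r = 1 := by
  simp [Ncyc, hx, hy, hx.neg.not_swap, hy.neg.not_swap]

theorem Ncyc_eq_zero {p q r : T1 × T1} (hx : CCWc p.1 q.1 r.1) (hy : CCWc p.2 r.2 q.2)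
    (hxy : CCWc (p.1 - p.2) (r.1 - r.2) (q.1 - q.2)) : Ncyc p q r = 0 := by
  simp [Ncyc, hy.not_swap, hx.neg.not_swap, hxy.not_swap]

theorem cyclically_ordered_disc_count_not_invariant :
    ∃ p q r p' q' r' : T1 × T1, Generic p q r ∧ Generic p' q' r' ∧
      Ncyc p q r = 1 ∧ Ncyc p' q' r' = 0 := by
  have h₁ : CCWc ((0 : ℝ) : T1) ((1 / 5 : ℝ) : T1) ((2 / 5 : ℝ) : T1) :=
    ⟨0, 1 / 5, 2 / 5, by norm_num, by norm_num, by norm_num, rfl, rfl, rfl⟩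
  have h₂ : CCWc ((0 : ℝ) : T1) ((1 / 10 : ℝ) : T1) ((1 / 5 : ℝ) : T1) :=
    ⟨0, 1 / 10, 1 / 5, by norm_num, by norm_num, by norm_num, rfl, rfl, rfl⟩
  have h₃ : CCWc (((0 : ℝ) : T1) - ((0 : ℝ) : T1)) (((1 / 5 : ℝ) : T1) - ((1 / 10 : ℝ) : T1))
      (((2 / 5 : ℝ) : T1) - ((1 / 5 : ℝ) : T1)) :=
    ⟨0 - 0, 1 / 5 - 1 / 10, 2 / 5 - 1 / 5, by norm_num, by norm_num, by norm_num, rfl, rfl, rfl⟩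
  have h₄ : CCWc ((0 : ℝ) : T1) ((1 / 5 : ℝ) : T1) ((3 / 10 : ℝ) : T1) :=
    ⟨0, 1 / 5, 3 / 10, by norm_num, by norm_num, by norm_num, rfl, rfl, rfl⟩
  have h₅ : CCWc ((0 : ℝ) : T1) ((1 / 10 : ℝ) : T1) ((3 / 10 : ℝ) : T1) :=
    ⟨0, 1 / 10, 3 / 10, by norm_num, by norm_num, by norm_num, rfl, rfl, rfl⟩
  have h₆ : CCWc (((0 : ℝ) : T1) - ((0 : ℝ) : T1)) (((3 / 10 : ℝ) : T1) - ((1 / 10 : ℝ) : T1))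
      (((1 / 5 : ℝ) : T1) - ((3 / 10 : ℝ) : T1)) :=
    ⟨0 - 0, 3 / 10 - 1 / 10, 1 / 5 - 3 / 10 + 1, by norm_num, by norm_num, by norm_num, rfl, rfl,
      ((T1.coe_eq_coe_iff (1 / 5 - 3 / 10) _).2 ⟨1, by push_cast; ring⟩).symm⟩
  exact ⟨((0 : ℝ), (0 : ℝ)), ((1 / 5 : ℝ), (1 / 10 : ℝ)), ((2 / 5 : ℝ), (1 / 5 : ℝ)),
    ((0 : ℝ), (0 : ℝ)), ((1 / 5 : ℝ), (3 / 10 : ℝ)), ((3 / 10 : ℝ), (1 / 10 : ℝ)),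
    .of_distinct3 h₁.distinct3 h₂.distinct3 h₃.distinct3,
    .of_distinct3 h₄.distinct3 h₅.distinct3.swap h₆.distinct3.swap,
    Ncyc_eq_one h₁ h₂, Ncyc_eq_zero h₄ h₅ h₆⟩
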